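/- arXiv:1406.1803 — 2 statements merged into one kernel-verified Lean document; each statement's English description precedes it below -/
import Mathlib

section
/- Let f: ℝ^d → ℝ be twice continuously differentiable with set of local modes 𝓜 = {x : ∇f(x) = 0 and the largest eigenvalue of ∇∇f(x) is negative}, and suppose there exist λ_0, λ_1, δ > 0 such that {x : λ_1(x) < −λ_1 and ‖∇f(x)‖_2 < λ_0} ⊂ 𝓜 ⊕ δ, where λ_1(x) denotes the largest eigenvalue of ∇∇f(x). Let g: ℝ^d → ℝ be twice continuously differentiable with sup_x ‖∇g(x) − ∇f(x)‖_2 ≤ λ_0/2 and sup_x ‖∇∇g(x) − ∇∇f(x)‖_max ≤ λ_1/(2d). Then every point x ∈ ℝ^d satisfying ∇g(x) = 0 and whose largest Hessian eigenvalue of g at x is less than −3λ_1/2 lies in 𝓜 ⊕ δ, i.e. within distance δ of some local mode of f. -/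
open MeasureTheory ProbabilityTheory Filter Real
open scoped BigOperators ENNReal Topology

noncomputable section

/-- `ℝ^d` with the Euclidean norm. -/
abbrev E (d : ℕ) := EuclideanSpace ℝ (Fin d)

/-- The standard Gaussian kernel `K(x) = (2π)^{-d/2} exp(-‖x‖²/2)` on `ℝ^d`. -/
def gaussK (d : ℕ) (v : E d) : ℝ :=
  (2 * Real.pi) ^ (-(d : ℝ) / 2) * Real.exp (-‖v‖ ^ 2 / 2)

/-- The generalized kernel density estimator
`f̂_n(x) = (1/(n h^d)) Σ_{i<n} Y_i K((x - X_i)/h)`. -/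
def fhat (d n : ℕ) (h : ℝ) (X : ℕ → E d) (Y : ℕ → ℝ) (x : E d) : ℝ :=
  ((n : ℝ) * h ^ d)⁻¹ * ∑ i ∈ Finset.range n, Y i * gaussK d (h⁻¹ • (x - X i))

/-- Partial derivative in the `i`-th coordinate direction. -/
def pd {d : ℕ} (i : Fin d) (g : E d → ℝ) : E d → ℝ :=
  fun x => fderiv ℝ g x (EuclideanSpace.single i 1)

/-- Iterated partial derivatives along a list of coordinate directions. -/
def pdList {d : ℕ} : List (Fin d) → (E d → ℝ) → (E d → ℝ)
  | [], g => g
  | i :: l, g => pd i (pdList l g)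

/-- The partial derivative `D^α g` for a multi-index `α`. -/
def mpderiv {d : ℕ} (α : Fin d → ℕ) (g : E d → ℝ) : E d → ℝ :=
  pdList ((List.finRange d).flatMap fun i => List.replicate (α i) i) g

/-- The finite set of multi-indices `α` on `{1,…,d}` with `|α| = k`. -/
def multiIdx (d k : ℕ) : Finset (Fin d → ℕ) :=
  (Fintype.piFinset fun _ : Fin d => Finset.range (k + 1)).filter fun α => ∑ i, α i = k

/-- `‖g‖*_{∞,k} ≤ t` : all partial derivatives of order `≤ k` are bounded by `t`. -/
def normStarLe (d k : ℕ) (g : E d → ℝ) (t : ℝ) : Prop :=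
  ∀ j ≤ k, ∀ α ∈ multiIdx d j, ∀ x, |mpderiv α g x| ≤ t

/-- The Hessian matrix of `g` at `x`. -/
def hess {d : ℕ} (g : E d → ℝ) (x : E d) : Matrix (Fin d) (Fin d) ℝ :=
  fun i j => pd i (pd j g) x

/-- Eigenvalues of a symmetric matrix, listed in decreasing order
`λ_1 ≥ λ_2 ≥ ⋯ ≥ λ_d` (junk value `0` for non-symmetric matrices). -/
def eigsDesc {d : ℕ} (A : Matrix (Fin d) (Fin d) ℝ) : Fin d → ℝ :=
  if hA : A.IsHermitian then
    fun k => hA.eigenvalues (Tuple.sort hA.eigenvalues (Fin.rev k)) else 0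

/-- The projector `V(x)V(x)^T` onto the span of eigenvectors `v_2,…,v_d`
corresponding to the eigenvalues `λ_2 ≥ ⋯ ≥ λ_d` (in decreasing order). -/
def projV {d : ℕ} (A : Matrix (Fin d) (Fin d) ℝ) : Matrix (Fin d) (Fin d) ℝ :=
  if hA : A.IsHermitian then
    ∑ k ∈ Finset.univ.filter fun k : Fin d => (k : ℕ) ≠ 0,
      Matrix.vecMulVec (fun j => hA.eigenvectorBasis (Tuple.sort hA.eigenvalues (Fin.rev k)) j)
        (fun j => hA.eigenvectorBasis (Tuple.sort hA.eigenvalues (Fin.rev k)) j)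
  else 0

/-- Max norm of a vector. -/
def vmax {d : ℕ} (v : Fin d → ℝ) : ℝ := ⨆ i, abs (v i)

/-- Entrywise max norm of a matrix. -/
def mnorm {d : ℕ} (M : Matrix (Fin d) (Fin d) ℝ) : ℝ := ⨆ i, ⨆ j, abs (M i j)

/-- The set of local modes `{x : ∇g(x) = 0, λ_1(x) < 0}`. -/
def modeSet {d : ℕ} (hd : 0 < d) (g : E d → ℝ) : Set (E d) :=
  {x | gradient g x = 0 ∧ eigsDesc (hess g x) ⟨0, hd⟩ < 0}

/-- The ridge `{x : V(x)V(x)^T ∇g(x) = 0, λ_2(x) < 0}`. -/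
def ridgeSet {d : ℕ} (hd : 1 < d) (g : E d → ℝ) : Set (E d) :=
  {x | Matrix.mulVec (projV (hess g x)) (fun i => gradient g x i) = 0 ∧
    eigsDesc (hess g x) ⟨1, hd⟩ < 0}

/-- The Hessian matrix of a `C²` function is symmetric. -/
theorem isHermitian_hess {d : ℕ} {g : E d → ℝ} (hg : ContDiff ℝ 2 g) (x : E d) :
    (hess g x).IsHermitian := by
  have hdiff : DifferentiableAt ℝ (fderiv ℝ g) x :=
    (hg.fderiv_right (m := 1) (by norm_num)).differentiable (by norm_num) x
  have hpd (i j : Fin d) : hess g x i j =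
      fderiv ℝ (fderiv ℝ g) x (EuclideanSpace.single i 1) (EuclideanSpace.single j 1) := by
    change fderiv ℝ (fun y => fderiv ℝ g y (EuclideanSpace.single j 1)) x _ = _
    rw [fderiv_clm_apply hdiff (differentiableAt_const _)]
    simp
  have hsymm : IsSymmSndFDerivAt ℝ g x := hg.contDiffAt.isSymmSndFDerivAt (by simp)
  ext i j
  simp only [Matrix.conjTranspose_apply, star_trivial, hpd]
  exact hsymm _ _

/-- The first entry of `eigsDesc` is an eigenvalue. -/
theorem exists_eigenvalues_eq_eigsDesc_zero {d : ℕ} (hd : 0 < d)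
    {A : Matrix (Fin d) (Fin d) ℝ} (hA : A.IsHermitian) :
    ∃ i, hA.eigenvalues i = eigsDesc A ⟨0, hd⟩ := by
  rw [eigsDesc, dif_pos hA]
  exact ⟨_, rfl⟩

/-- The first entry of `eigsDesc` bounds all eigenvalues. -/
theorem eigenvalues_le_eigsDesc_zero {d : ℕ} (hd : 0 < d)
    {A : Matrix (Fin d) (Fin d) ℝ} (hA : A.IsHermitian) (i : Fin d) :
    hA.eigenvalues i ≤ eigsDesc A ⟨0, hd⟩ := by
  have hle : (Tuple.sort hA.eigenvalues).symm i ≤ Fin.rev ⟨0, hd⟩ := by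
    rw [Fin.le_def, Fin.val_rev]
    have := ((Tuple.sort hA.eigenvalues).symm i).isLt
    simp only
    omega
  rw [eigsDesc, dif_pos hA]
  simpa using Tuple.monotone_sort hA.eigenvalues hle

/-- The quadratic form of a symmetric matrix is bounded by its largest eigenvalue. -/
theorem inner_toEuclideanLin_le_eigsDesc_zero {d : ℕ} (hd : 0 < d)
    {A : Matrix (Fin d) (Fin d) ℝ} (hA : A.IsHermitian) (v : E d) :
    inner ℝ v (Matrix.toEuclideanLin A v) ≤ eigsDesc A ⟨0, hd⟩ * ‖v‖ ^ 2 := by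
  have hb (i : Fin d) : Matrix.toEuclideanLin A (hA.eigenvectorBasis i) =
      hA.eigenvalues i • hA.eigenvectorBasis i := by
    ext j
    exact congrFun (hA.mulVec_eigenvectorBasis i) j
  have hsymm := Matrix.isSymmetric_toEuclideanLin_iff.2 hA
  rw [← hA.eigenvectorBasis.sum_inner_mul_inner, ← real_inner_self_eq_norm_sq,
    ← hA.eigenvectorBasis.sum_inner_mul_inner v v, Finset.mul_sum]
  refine Finset.sum_le_sum fun i _ => ?_
  rw [← hsymm, hb, real_inner_smul_left, real_inner_comm v (hA.eigenvectorBasis i)]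
  nlinarith [eigenvalues_le_eigsDesc_zero hd hA i,
    mul_self_nonneg (inner ℝ (hA.eigenvectorBasis i) v)]

theorem abs_apply_le_mnorm {d : ℕ} (M : Matrix (Fin d) (Fin d) ℝ) (i j : Fin d) :
    |M i j| ≤ mnorm M :=
  (le_ciSup (f := fun j => |M i j|) (Set.finite_range _).bddAbove j).trans
    (le_ciSup (f := fun i => ⨆ j, |M i j|) (Set.finite_range _).bddAbove i)

/-- The quadratic form of a `d × d` matrix is bounded by `d` times its max norm. -/
theorem abs_inner_toEuclideanLin_le {d : ℕ} (M : Matrix (Fin d) (Fin d) ℝ) (v : E d) :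
    |inner ℝ v (Matrix.toEuclideanLin M v)| ≤ d * mnorm M * ‖v‖ ^ 2 := by
  rcases Nat.eq_zero_or_pos d with rfl | hd
  · simp [Subsingleton.elim v 0]
  have hm : 0 ≤ mnorm M := (abs_nonneg _).trans (abs_apply_le_mnorm M ⟨0, hd⟩ ⟨0, hd⟩)
  have hexp : inner ℝ v (Matrix.toEuclideanLin M v) = ∑ i, ∑ j, v i * (M i j * v j) := by
    simp [PiLp.inner_apply, Matrix.toLpLin_apply, Matrix.mulVec, dotProduct, Finset.mul_sum,
      mul_comm]
  have hcs : (∑ i, |v i|) ^ 2 ≤ d * ‖v‖ ^ 2 := by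
    simpa [EuclideanSpace.norm_sq_eq] using
      sq_sum_le_card_mul_sum_sq (s := Finset.univ) (f := fun i => |v i|)
  calc |inner ℝ v (Matrix.toEuclideanLin M v)|
      ≤ ∑ i, ∑ j, |v i * (M i j * v j)| := by
        rw [hexp]
        exact (Finset.abs_sum_le_sum_abs _ _).trans
          (Finset.sum_le_sum fun i _ => Finset.abs_sum_le_sum_abs _ _)
    _ ≤ ∑ i, ∑ j, mnorm M * (|v i| * |v j|) := by
        refine Finset.sum_le_sum fun i _ => Finset.sum_le_sum fun j _ => ?_
        rw [abs_mul, abs_mul, mul_left_comm]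
        exact mul_le_mul_of_nonneg_right (abs_apply_le_mnorm M i j) (by positivity)
    _ = mnorm M * (∑ i, |v i|) ^ 2 := by
        rw [sq, Finset.sum_mul_sum]
        simp only [Finset.mul_sum]
    _ ≤ mnorm M * (d * ‖v‖ ^ 2) := mul_le_mul_of_nonneg_left hcs hm
    _ = d * mnorm M * ‖v‖ ^ 2 := by ring

/-- Weyl's inequality for the largest eigenvalue, in terms of the max norm. -/
theorem eigsDesc_zero_le_add_mnorm {d : ℕ} (hd : 0 < d) {A B : Matrix (Fin d) (Fin d) ℝ}
    (hA : A.IsHermitian) (hB : B.IsHermitian) :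
    eigsDesc A ⟨0, hd⟩ ≤ eigsDesc B ⟨0, hd⟩ + d * mnorm (B - A) := by
  obtain ⟨i, hi⟩ := exists_eigenvalues_eq_eigsDesc_zero hd hA
  set v := hA.eigenvectorBasis i
  have hv : ‖v‖ = 1 := hA.eigenvectorBasis.orthonormal.1 i
  have hAv : Matrix.toEuclideanLin A v = hA.eigenvalues i • v := by
    ext j
    exact congrFun (hA.mulVec_eigenvectorBasis i) j
  have hBv := inner_toEuclideanLin_le_eigsDesc_zero hd hB v
  have hdiff := neg_le_of_abs_le (abs_inner_toEuclideanLin_le (B - A) v)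
  rw [map_sub, LinearMap.sub_apply, inner_sub_right, hAv, real_inner_smul_right,
    real_inner_self_eq_norm_sq, hi, hv] at hdiff
  rw [hv] at hBv
  linarith

/-- approximate local modes lie near true local modes. -/
theorem statement_10 (d : ℕ) (hd : 0 < d) (f : E d → ℝ) (hf : ContDiff ℝ 2 f)
    (lam0 lam1 δ : ℝ) (hlam0 : 0 < lam0) (hlam1 : 0 < lam1) (hδ : 0 < δ)
    (hM : {x | eigsDesc (hess f x) ⟨0, hd⟩ < -lam1 ∧ ‖gradient f x‖ < lam0}
      ⊆ Metric.cthickening δ (modeSet hd f))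
    (g : E d → ℝ) (hg : ContDiff ℝ 2 g)
    (hgrad : ∀ x, ‖gradient g x - gradient f x‖ ≤ lam0 / 2)
    (hhess : ∀ x, mnorm (hess g x - hess f x) ≤ lam1 / (2 * d)) :
    ∀ x, gradient g x = 0 → eigsDesc (hess g x) ⟨0, hd⟩ < -(3 * lam1 / 2) →
      x ∈ Metric.cthickening δ (modeSet hd f) := by
  intro x hx hlam
  refine hM ⟨?_, ?_⟩
  · have hweyl := eigsDesc_zero_le_add_mnorm hd (isHermitian_hess hf x) (isHermitian_hess hg x)
    have hd' : (0 : ℝ) < d := by exact_mod_cast hd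
    have hbound : d * mnorm (hess g x - hess f x) ≤ lam1 / 2 :=
      (mul_le_mul_of_nonneg_left (hhess x) hd'.le).trans_eq (by field_simp)
    linarith
  · have hfx := hgrad x
    rw [hx, zero_sub, norm_neg] at hfx
    linarith

end
end

section
/- Let f: ℝ^d → ℝ be bounded and three times continuously differentiable with all partial derivatives up to order 3 bounded, and let K be the standard Gaussian kernel on ℝ^d. Then there exists a constant C > 0 such that for all x ∈ ℝ^d and all h ∈ (0,1], ‖ h^{−(d+1)} ∫_{ℝ^d} (∇K)((x−u)/h) f(u) du − ∇f(x) ‖_2 ≤ C h². (This is the bias bound E[∇f̂_n(x)] − ∇f(x) = O(h²) used in the mode estimation theorem, since E[∇f̂_n(x)] = h^{−(d+1)} ∫ (∇K)((x−u)/h) f(u) du when f is the generalized density.) -/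
open MeasureTheory ProbabilityTheory Filter Real
open scoped BigOperators ENNReal Topology

noncomputable section

section PartialDerivatives

variable {d : ℕ}

lemma contDiff_pd {n : ℕ} {g : E d → ℝ} (hg : ContDiff ℝ (n + 1 : ℕ) g) (i : Fin d) :
    ContDiff ℝ n (pd i g) :=
  (hg.fderiv_right (by norm_cast)).clm_apply contDiff_const

lemma contDiff_pdList {n : ℕ} {g : E d → ℝ} (l : List (Fin d))
    (hg : ContDiff ℝ (n + l.length : ℕ) g) : ContDiff ℝ n (pdList l g) := by
  induction l generalizing n with
  | nil => exact hg
  | cons i l ih =>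
    refine contDiff_pd (ih ?_) i
    convert hg using 2
    simp only [List.length_cons]
    ring_nf

lemma pd_comm {g : E d → ℝ} (hg : ContDiff ℝ 2 g) (i j : Fin d) :
    pd i (pd j g) = pd j (pd i g) := by
  have hd : Differentiable ℝ (fderiv ℝ g) :=
    (hg.fderiv_right (m := 1) (by norm_num)).differentiable (by norm_num)
  have key (i j : Fin d) (x : E d) : pd i (pd j g) x =
      fderiv ℝ (fderiv ℝ g) x (EuclideanSpace.single i 1) (EuclideanSpace.single j 1) := by
    change fderiv ℝ (fun y => fderiv ℝ g y (EuclideanSpace.single j 1)) x _ = _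
    rw [fderiv_clm_apply (hd x) (differentiableAt_const _)]
    simp
  ext x
  rw [key, key]
  exact (hg.contDiffAt.isSymmSndFDerivAt (by simp)).eq _ _

lemma pdList_eq_of_perm {l l' : List (Fin d)} (h : l.Perm l') {g : E d → ℝ}
    (hg : ContDiff ℝ l.length g) : pdList l g = pdList l' g := by
  induction h with
  | nil => rfl
  | cons i _ ih =>
    simp only [pdList]
    rw [ih (hg.of_le (by simp only [List.length_cons]; norm_cast; omega))]
  | swap i j l =>
    refine pd_comm ?_ j i
    refine contDiff_pdList (n := 2) l ?_
    convert hg using 2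
    simp only [List.length_cons]
    ring
  | trans h₁ _ ih₁ ih₂ => exact (ih₁ hg).trans (ih₂ (h₁.length_eq ▸ hg))

lemma perm_flatMap_replicate_count (l : List (Fin d)) :
    l.Perm ((List.finRange d).flatMap fun i => List.replicate (l.count i) i) := by
  rw [List.perm_iff_count]
  intro a
  rw [List.count_flatMap]
  have : (List.count a ∘ fun i => List.replicate (l.count i) i) =
      fun i => if i = a then l.count a else 0 := by
    ext i
    by_cases h : i = a
    · simp [h]
    · simp [List.count_replicate, h]
  rw [this, ← List.ofFn_eq_map, List.sum_ofFn]
  simp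

lemma abs_pdList_le {n : ℕ} {g : E d → ℝ} {B : ℝ} (hg : ContDiff ℝ n g)
    (hB : normStarLe d n g B) {l : List (Fin d)} (hl : l.length ≤ n) (x : E d) :
    |pdList l g x| ≤ B := by
  have hsum : ∑ i, l.count i = l.length := by
    have := (perm_flatMap_replicate_count l).length_eq
    rw [List.length_flatMap] at this
    simp only [List.length_replicate] at this
    rw [← List.ofFn_eq_map, List.sum_ofFn] at this
    exact this.symm
  have hmem : (fun i => l.count i) ∈ multiIdx d l.length := by
    simp only [multiIdx, Finset.mem_filter, Fintype.mem_piFinset, Finset.mem_range]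
    exact ⟨fun i => Nat.lt_succ_of_le List.count_le_length, hsum⟩
  have := hB l.length hl _ hmem x
  rwa [mpderiv, ← pdList_eq_of_perm (perm_flatMap_replicate_count l)
    (hg.of_le (by exact_mod_cast hl))] at this

lemma fderiv_apply_eq_sum_pd (g : E d → ℝ) (x v : E d) :
    fderiv ℝ g x v = ∑ i, v i * pd i g x := by
  conv_lhs => rw [← (EuclideanSpace.basisFun (Fin d) ℝ).sum_repr v]
  simp [pd]

lemma hasDerivAt_comp_line {g : E d → ℝ} (hg : ContDiff ℝ 1 g) (x v : E d) (t : ℝ) :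
    HasDerivAt (fun s : ℝ => g (x + s • v)) (∑ i, v i * pd i g (x + t • v)) t := by
  rw [← fderiv_apply_eq_sum_pd]
  have h₁ : HasDerivAt (fun s : ℝ => x + s • v) v t := by
    simpa using ((hasDerivAt_id t).smul_const v).const_add x
  exact ((hg.differentiable (by norm_num)) _).hasFDerivAt.comp_hasDerivAt t h₁

end PartialDerivatives

section CentralDifference

lemma abs_le_pow_succ_of_hasDerivAt {ψ ψ' : ℝ → ℝ} {C : ℝ} {n : ℕ} (hC : 0 ≤ C)
    (hψ : ∀ t, HasDerivAt ψ (ψ' t) t) (h₀ : ψ 0 = 0) (hb : ∀ t, 0 ≤ t → |ψ' t| ≤ C * t ^ n)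
    (t : ℝ) (ht : 0 ≤ t) : |ψ t| ≤ C * t ^ (n + 1) := by
  have := (convex_Icc 0 t).norm_image_sub_le_of_norm_hasDerivWithin_le
    (f := ψ) (C := C * t ^ n)
    (fun s _ => (hψ s).hasDerivWithinAt)
    (fun s hs => (hb s hs.1).trans (by have := hs.1; have := hs.2; gcongr))
    (Set.left_mem_Icc.2 ht) (Set.right_mem_Icc.2 ht)
  rw [h₀, sub_zero, sub_zero, Real.norm_eq_abs, Real.norm_of_nonneg ht] at this
  rwa [pow_succ, ← mul_assoc]

lemma abs_central_difference_le {g g₁ g₂ g₃ : ℝ → ℝ} {M : ℝ} (h₁ : ∀ t, HasDerivAt g (g₁ t) t)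
    (h₂ : ∀ t, HasDerivAt g₁ (g₂ t) t) (h₃ : ∀ t, HasDerivAt g₂ (g₃ t) t)
    (hM : ∀ t, |g₃ t| ≤ M) (t : ℝ) (ht : 0 ≤ t) :
    |g t - g (-t) - 2 * t * g₁ 0| ≤ 2 * M * t ^ 3 := by
  have hM0 : 0 ≤ 2 * M := by linarith [abs_nonneg (g₃ 0), hM 0]
  have refl {u u' : ℝ → ℝ} (hu : ∀ t, HasDerivAt u (u' t) t) (t : ℝ) :
      HasDerivAt (fun s => u (-s)) (-u' (-t)) t := by
    simpa [Function.comp_def] using (hu (-t)).comp t (hasDerivAt_neg t)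
  have b₂ := abs_le_pow_succ_of_hasDerivAt (ψ := fun t => g₂ t - g₂ (-t))
    (ψ' := fun t => g₃ t - -g₃ (-t)) (n := 0) hM0
    (fun t => (h₃ t).sub (refl h₃ t)) (by simp) (fun t _ => by
      have := abs_sub (g₃ t) (-g₃ (-t))
      rw [abs_neg] at this
      linarith [hM t, hM (-t)])
  have b₁ := abs_le_pow_succ_of_hasDerivAt (ψ := fun t => g₁ t + g₁ (-t) - 2 * g₁ 0)
    (ψ' := fun t => g₂ t - g₂ (-t)) (n := 1) hM0
    (fun t => by simpa [sub_eq_add_neg] using ((h₂ t).add (refl h₂ t)).sub_const (2 * g₁ 0))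
    (by simp; ring) (by simpa using b₂)
  exact abs_le_pow_succ_of_hasDerivAt (ψ := fun t => g t - g (-t) - 2 * t * g₁ 0)
    (ψ' := fun t => g₁ t + g₁ (-t) - 2 * g₁ 0) (n := 2) hM0
    (fun t => by
      have := ((h₁ t).fun_sub (refl h₁ t)).fun_sub (((hasDerivAt_id t).const_mul 2).mul_const (g₁ 0))
      simpa using this)
    (by simp) b₁ t ht

lemma abs_sub_sub_fderiv_le {d : ℕ} {f : E d → ℝ} {B : ℝ} (hf : ContDiff ℝ 3 f)
    (hB : normStarLe d 3 f B) (x v : E d) {h : ℝ} (hh : 0 ≤ h) :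
    |f (x + h • v) - f (x - h • v) - 2 * h * fderiv ℝ f x v| ≤
      2 * (d ^ 3 * ‖v‖ ^ 3 * B) * h ^ 3 := by
  have hf' : ContDiff ℝ (3 : ℕ) f := hf
  have hp1 (i : Fin d) : ContDiff ℝ 2 (pd i f) := contDiff_pd (n := 2) hf' i
  have hp2 (i j : Fin d) : ContDiff ℝ 1 (pd j (pd i f)) := contDiff_pd (n := 1) (hp1 i) j
  have h₁ := hasDerivAt_comp_line (hf.of_le (by norm_num)) x v
  have h₂ (t : ℝ) := HasDerivAt.fun_sum (u := Finset.univ) fun i _ =>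
    (hasDerivAt_comp_line ((hp1 i).of_le (by norm_num)) x v t).const_mul (v i)
  have h₃ (t : ℝ) := HasDerivAt.fun_sum (u := Finset.univ) fun i _ =>
    (HasDerivAt.fun_sum (u := Finset.univ) fun j _ =>
      (hasDerivAt_comp_line (hp2 i j) x v t).const_mul (v j)).const_mul (v i)
  have hv (i : Fin d) : |v i| ≤ ‖v‖ := PiLp.norm_apply_le v i
  have hsum {u : Fin d → ℝ} {C : ℝ} (hu : ∀ i, |u i| ≤ C) : |∑ i, v i * u i| ≤ d * ‖v‖ * C := by
    calc |∑ i, v i * u i| ≤ ∑ i, |v i * u i| := Finset.abs_sum_le_sum_abs _ _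
      _ ≤ ∑ _i : Fin d, ‖v‖ * C := Finset.sum_le_sum fun i _ => by
        rw [abs_mul]
        exact mul_le_mul (hv i) (hu i) (abs_nonneg _) (norm_nonneg _)
      _ = d * ‖v‖ * C := by simp [mul_assoc]
  have hM (t : ℝ) := hsum fun i => hsum fun j => hsum fun k =>
    abs_pdList_le hf' hB (l := [k, j, i]) (by simp) (x + t • v)
  have key := abs_central_difference_le h₁ h₂ h₃ hM h hh
  simp only [zero_smul, add_zero, neg_smul, ← sub_eq_add_neg] at key
  rw [← fderiv_apply_eq_sum_pd] at key
  refine key.trans_eq ?_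
  ring

end CentralDifference

section GaussianKernel

variable {d : ℕ}

lemma gaussK_nonneg (v : E d) : 0 ≤ gaussK d v := by
  unfold gaussK
  positivity

lemma gaussK_neg (v : E d) : gaussK d (-v) = gaussK d v := by
  simp [gaussK]

lemma hasFDerivAt_gaussK (v : E d) :
    HasFDerivAt (gaussK d) (-gaussK d v • innerSL ℝ v) v := by
  have h₁ : HasFDerivAt (fun w : E d => ‖w‖ ^ 2) (2 • innerSL ℝ v) v :=
    (hasStrictFDerivAt_norm_sq v).hasFDerivAt
  have h₂ := ((h₁.const_mul (-1 / 2)).exp).const_mul ((2 * Real.pi) ^ (-(d : ℝ) / 2))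
  convert! h₂ using 1
  · ext w
    simp only [gaussK]
    congr 2
    ring
  · ext w
    simp only [gaussK, _root_.smul_apply, smul_eq_mul, nsmul_eq_mul]
    rw [show -‖v‖ ^ 2 / 2 = -1 / 2 * ‖v‖ ^ 2 by ring]
    simp
    ring

lemma continuous_gaussK : Continuous (gaussK d) :=
  continuous_iff_continuousAt.2 fun v => (hasFDerivAt_gaussK v).continuousAt

lemma gradient_gaussK (v : E d) : gradient (gaussK d) v = -gaussK d v • v := by
  rw [gradient, (hasFDerivAt_gaussK v).fderiv, map_smul]
  congr 1
  exact (InnerProductSpace.toDual ℝ (E d)).symm_apply_apply v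

lemma integral_gaussK : ∫ v, gaussK d v = 1 := by
  have := GaussianFourier.integral_rexp_neg_mul_sq_norm (V := E d) (b := 1 / 2) (by norm_num)
  simp only [gaussK, integral_const_mul]
  simp only [show ∀ v : E d, -‖v‖ ^ 2 / 2 = -(1 / 2) * ‖v‖ ^ 2 from fun v => by ring]
  rw [this, finrank_euclideanSpace_fin, show Real.pi / (1 / 2) = 2 * Real.pi by ring,
    ← Real.rpow_add (by positivity)]
  ring_nf
  simp

lemma integrable_rexp_neg_mul_sq_norm {b : ℝ} (hb : 0 < b) :
    Integrable fun v : E d => Real.exp (-b * ‖v‖ ^ 2) := by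
  have := (GaussianFourier.integrable_cexp_neg_mul_sq_norm_add (V := E d) (b := (b : ℂ))
    (by simpa using hb) 0 0).norm
  refine this.congr (.of_forall fun v => ?_)
  simp only [Complex.norm_exp, zero_mul, add_zero]
  norm_cast

lemma integrable_gaussK_smul {F : Type*} [NormedAddCommGroup F] [NormedSpace ℝ F] {g : E d → F}
    (hg : AEStronglyMeasurable g) {C : ℝ} (hC : ∀ v, ‖g v‖ ≤ C * (1 + ‖v‖ ^ 4)) :
    Integrable fun v => gaussK d v • g v := by
  have hC0 : 0 ≤ C := by simpa using (norm_nonneg _).trans (hC 0)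
  refine ((integrable_rexp_neg_mul_sq_norm (d := d) (b := 1 / 4) (by norm_num)).const_mul
    ((2 * Real.pi) ^ (-(d : ℝ) / 2) * C * 33)).mono'
    (continuous_gaussK.aestronglyMeasurable.smul hg) (.of_forall fun v => ?_)
  have h₁ : 1 + ‖v‖ ^ 4 ≤ 33 * Real.exp (‖v‖ ^ 2 / 4) := by
    have h := Real.quadratic_le_exp_of_nonneg (x := ‖v‖ ^ 2 / 4) (by positivity)
    nlinarith [sq_nonneg ‖v‖, sq_nonneg (‖v‖ ^ 2)]
  rw [norm_smul, Real.norm_of_nonneg (gaussK_nonneg v), gaussK]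
  calc (2 * Real.pi) ^ (-(d : ℝ) / 2) * Real.exp (-‖v‖ ^ 2 / 2) * ‖g v‖
      ≤ (2 * Real.pi) ^ (-(d : ℝ) / 2) * Real.exp (-‖v‖ ^ 2 / 2) *
          (C * (33 * Real.exp (‖v‖ ^ 2 / 4))) := by
        gcongr
        exact (hC v).trans (by gcongr)
    _ = (2 * Real.pi) ^ (-(d : ℝ) / 2) * C * 33 *
          (Real.exp (-‖v‖ ^ 2 / 2) * Real.exp (‖v‖ ^ 2 / 4)) := by ring
    _ = _ := by rw [← Real.exp_add]; ring_nf

lemma integrable_gaussK : Integrable (gaussK d) := by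
  have := integrable_gaussK_smul (d := d) (g := fun _ => (1 : ℝ)) aestronglyMeasurable_const
    (C := 1) (fun v => by simp)
  simpa using this

lemma le_one_add_pow_four (r : ℝ) : r ≤ 1 + r ^ 4 := by
  nlinarith [sq_nonneg (r ^ 2 - 1), sq_nonneg (r - 1)]

lemma sq_le_one_add_pow_four (r : ℝ) : r ^ 2 ≤ 1 + r ^ 4 := by
  nlinarith [sq_nonneg (r ^ 2 - 1)]

lemma integrable_gaussK_smul_inner_smul (a : E d) :
    Integrable fun v : E d => gaussK d v • (inner ℝ a v • v) := by
  refine integrable_gaussK_smul (by fun_prop) (C := ‖a‖) fun v => ?_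
  calc ‖inner ℝ a v • v‖ ≤ ‖a‖ * ‖v‖ * ‖v‖ := by
        rw [norm_smul]
        gcongr
        exact norm_inner_le_norm a v
    _ = ‖a‖ * ‖v‖ ^ 2 := by ring
    _ ≤ _ := by gcongr; exact sq_le_one_add_pow_four _

/-- The covariance matrix of the standard Gaussian kernel is the identity. -/
lemma integral_gaussK_smul_inner_smul (a : E d) :
    ∫ v : E d, gaussK d v • (inner ℝ a v • v) = a := by
  refine ext_inner_left ℝ fun w => ?_
  rw [← integral_inner (integrable_gaussK_smul_inner_smul a)]
  have hfa (v : E d) : fderiv ℝ (fun y : E d => inner ℝ a y) v w = inner ℝ a w := by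
    rw [show (fun y : E d => inner ℝ a y) = innerSL ℝ a from rfl,
      ContinuousLinearMap.fderiv]
    rfl
  have hfK (v : E d) : fderiv ℝ (gaussK d) v w = -(gaussK d v * inner ℝ v w) := by
    rw [(hasFDerivAt_gaussK v).fderiv]
    simp
  have hprod : (fun v : E d => inner ℝ a v * fderiv ℝ (gaussK d) v w) =
      fun v => -inner ℝ w (gaussK d v • (inner ℝ a v • v)) := by
    ext v
    rw [hfK, inner_smul_right, inner_smul_right, real_inner_comm v w]
    ring
  have hibp := integral_mul_fderiv_eq_neg_fderiv_mul_of_integrable (μ := volume)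
    (f := fun y : E d => inner ℝ a y) (g := gaussK d) (v := w)
    (by simpa only [hfa] using integrable_gaussK.const_mul _)
    (by rw [hprod]; exact ((integrable_gaussK_smul_inner_smul a).const_inner w).neg)
    (by
      have := integrable_gaussK_smul (d := d) (g := fun v => inner ℝ a v) (by fun_prop)
        (C := ‖a‖) fun v => (norm_inner_le_norm a v).trans
          (by gcongr; exact le_one_add_pow_four _)
      simpa only [smul_eq_mul, mul_comm] using this)
    (fun v _ => (innerSL ℝ a).differentiableAt)
    (fun v _ => (hasFDerivAt_gaussK v).differentiableAt)
  simp only [hfa, integral_const_mul, integral_gaussK, mul_one] at hibp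
  rw [hprod, integral_neg, neg_inj] at hibp
  rw [hibp, real_inner_comm]

end GaussianKernel

section Bias

variable {d : ℕ}

lemma integral_smul_gradient_gaussK_comp (f : E d → ℝ) (x : E d) {h : ℝ} (hh : 0 < h) :
    ∫ u, f u • gradient (gaussK d) (h⁻¹ • (x - u)) =
      h ^ d • ∫ v, gaussK d v • (f (x + h • v) • v) := by
  let G : E d → E d := fun v => gaussK d v • (f (x + h • v) • v)
  have h₁ (u : E d) : f u • gradient (gaussK d) (h⁻¹ • (x - u)) = G (h⁻¹ • (-(x - u))) := by
    simp only [G, gradient_gaussK, smul_neg, gaussK_neg, smul_inv_smul₀ hh.ne', neg_smul, ← sub_eq_add_neg,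
      sub_sub_cancel]
    rw [smul_comm]
  simp only [h₁]
  rw [integral_sub_left_eq_self (fun y => G (h⁻¹ • (-y))) volume x,
    integral_neg_eq_self (fun y => G (h⁻¹ • y)) volume,
    Measure.integral_comp_inv_smul_of_nonneg _ _ hh.le, finrank_euclideanSpace_fin]

lemma integrable_gaussK_smul_comp_smul {f : E d → ℝ} {B : ℝ} (hf : Continuous f)
    (hB : ∀ x, |f x| ≤ B) (x : E d) (h : ℝ) :
    Integrable fun v : E d => gaussK d v • (f (x + h • v) • v) := by
  have hB0 : 0 ≤ B := (abs_nonneg _).trans (hB x)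
  refine integrable_gaussK_smul (Continuous.aestronglyMeasurable (by fun_prop)) (C := B)
    fun v => ?_
  rw [norm_smul, Real.norm_eq_abs]
  exact mul_le_mul (hB _) (le_one_add_pow_four _) (norm_nonneg _) hB0

lemma two_smul_integral_gaussK_smul_comp_smul {f : E d → ℝ} {B : ℝ} (hf : Continuous f)
    (hB : ∀ x, |f x| ≤ B) (x : E d) (h : ℝ) :
    (2 : ℝ) • ∫ v, gaussK d v • (f (x + h • v) • v) =
      ∫ v, gaussK d v • ((f (x + h • v) - f (x - h • v)) • v) := by
  have hi := integrable_gaussK_smul_comp_smul hf hB x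
  have hneg := integral_neg_eq_self (fun v => gaussK d v • (f (x + h • v) • v)) volume
  simp only [gaussK_neg, smul_neg, ← sub_eq_add_neg] at hneg
  rw [integral_neg] at hneg
  have hi' := hi (-h)
  simp only [neg_smul, ← sub_eq_add_neg] at hi'
  simp only [sub_smul, smul_sub]
  rw [integral_sub (hi h) hi', two_smul]
  nth_rewrite 2 [← hneg]
  rw [sub_eq_add_neg]

end Bias

/-- the bias of the gradient estimator is `O(h²)`. -/
theorem statement_13 (d : ℕ) (f : E d → ℝ) (hf3 : ContDiff ℝ 3 f)
    (hbd : ∃ B : ℝ, ∀ j ≤ 3, ∀ α ∈ multiIdx d j, ∀ x, |mpderiv α f x| ≤ B) :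
    ∃ C > (0 : ℝ), ∀ (x : E d) (h : ℝ), 0 < h → h ≤ 1 →
      ‖(h ^ (d + 1) : ℝ)⁻¹ • (∫ u, f u • gradient (gaussK d) (h⁻¹ • (x - u)))
          - gradient f x‖ ≤ C * h ^ 2 := by
  obtain ⟨B, hB⟩ := hbd
  have hf : Continuous f := hf3.continuous
  have hfB (x : E d) : |f x| ≤ B := abs_pdList_le (n := 3) (l := []) hf3 hB (by simp) x
  have hB0 : 0 ≤ B := (abs_nonneg _).trans (hfB 0)
  have hmom : Integrable fun v : E d => gaussK d v * ‖v‖ ^ 4 :=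
    integrable_gaussK_smul (g := fun v => ‖v‖ ^ 4) (by fun_prop) (C := 1) fun v => by simp
  have hI0 : 0 ≤ ∫ v : E d, gaussK d v * ‖v‖ ^ 4 :=
    integral_nonneg fun v => mul_nonneg (gaussK_nonneg v) (by positivity)
  refine ⟨d ^ 3 * B * (∫ v : E d, gaussK d v * ‖v‖ ^ 4) + 1, by positivity, fun x h hh _ => ?_⟩
  have hi := integrable_gaussK_smul_comp_smul hf hfB x
  have hi' := hi (-h)
  simp only [neg_smul, ← sub_eq_add_neg] at hi'
  have hgrad (v : E d) : inner ℝ (gradient f x) v = fderiv ℝ f x v := by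
    simp [gradient]
  have hbias : (h ^ (d + 1) : ℝ)⁻¹ • (∫ u, f u • gradient (gaussK d) (h⁻¹ • (x - u)))
      - gradient f x = ∫ v, gaussK d v • (((2 * h)⁻¹ *
        (f (x + h • v) - f (x - h • v) - 2 * h * fderiv ℝ f x v)) • v) := by
    have hint : Integrable fun v => gaussK d v • ((f (x + h • v) - f (x - h • v)) • v) := by
      simpa only [sub_smul, smul_sub] using! (hi h).sub hi'
    rw [integral_smul_gradient_gaussK_comp f x hh, smul_smul]
    have h₁ : (h ^ (d + 1))⁻¹ * h ^ d = (2 * h)⁻¹ * 2 := by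
      field_simp
      ring
    rw [h₁, mul_smul, two_smul_integral_gaussK_smul_comp_smul hf hfB, ← integral_smul]
    conv_lhs => rw [← integral_gaussK_smul_inner_smul (gradient f x)]
    rw [← integral_sub (hint.fun_smul _) (integrable_gaussK_smul_inner_smul _)]
    congr 1
    ext1 v
    rw [hgrad, smul_comm, ← smul_sub, smul_smul, ← sub_smul, mul_sub _ _ (2 * h * _),
      inv_mul_cancel_left₀ (by positivity)]
  rw [hbias]
  have hle := norm_integral_le_of_norm_le (hmom.const_mul (d ^ 3 * B * h ^ 2))
    (.of_forall fun v => ?_) (f := fun v => gaussK d v • (((2 * h)⁻¹ *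
        (f (x + h • v) - f (x - h • v) - 2 * h * fderiv ℝ f x v)) • v))
  · refine hle.trans ?_
    rw [integral_const_mul]
    nlinarith [sq_nonneg h]
  · rw [norm_smul, norm_smul, Real.norm_of_nonneg (gaussK_nonneg v), Real.norm_eq_abs, abs_mul,
      abs_of_pos (by positivity : 0 < (2 * h)⁻¹)]
    calc gaussK d v * ((2 * h)⁻¹ *
          |f (x + h • v) - f (x - h • v) - 2 * h * fderiv ℝ f x v| * ‖v‖)
        ≤ gaussK d v * ((2 * h)⁻¹ * (2 * (d ^ 3 * ‖v‖ ^ 3 * B) * h ^ 3) * ‖v‖) := by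
          have := gaussK_nonneg v
          gcongr
          exact abs_sub_sub_fderiv_le hf3 hB x v hh.le
      _ = d ^ 3 * B * h ^ 2 * (gaussK d v * ‖v‖ ^ 4) := by
          field_simp

end
end
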